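/- In the Migliore construction with α ≥ β + n − 2, if s ≥ β + 2, then the minimum socle degree A_n equals β, and hence d(Γ) = β = A_n. -/

import Mathlib

open MvPolynomial

noncomputable section

namespace PointsMinDist

variable {K : Type} [Field K]

/-- The (homogeneous) vanishing ideal of a set of points of projective space:
all polynomials vanishing at every representative vector of every point. -/
def vanishingIdeal {m : ℕ} (Γ : Set (Projectivization K (Fin m → K))) :
    Ideal (MvPolynomial (Fin m) K) where
  carrier := {f | ∀ P ∈ Γ, ∀ (v : Fin m → K) (hv : v ≠ 0),
      Projectivization.mk K v hv = P → MvPolynomial.eval v f = 0}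
  zero_mem' := by intro P hP v hv h; simp
  add_mem' := by
    intro f g hf hg P hP v hv h
    simp [hf P hP v hv h, hg P hP v hv h]
  smul_mem' := by
    intro c f hf P hP v hv h
    simp [smul_eq_mul, hf P hP v hv h]

/-- The degree-`d` graded component of a (homogeneous) ideal, as a `K`-subspace. -/
def degPart {m : ℕ} (I : Ideal (MvPolynomial (Fin m) K)) (d : ℕ) :
    Submodule K (MvPolynomial (Fin m) K) :=
  Submodule.restrictScalars K I ⊓ homogeneousSubmodule (Fin m) K d

/-- `K`-dimension of the degree-`d` component of an ideal. -/
def hdim {m : ℕ} (I : Ideal (MvPolynomial (Fin m) K)) (d : ℕ) : ℕ :=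
  Module.finrank K (degPart I d)

/-- Hilbert function of `R/I` in degree `d`. -/
def HF {m : ℕ} (I : Ideal (MvPolynomial (Fin m) K)) (d : ℕ) : ℕ :=
  Module.finrank K (homogeneousSubmodule (Fin m) K d) - hdim I d

open Classical in
/-- `hyp Γ`: the maximum number of points of `Γ` contained in a hyperplane. -/
def hyp {m : ℕ} (Γ : Finset (Projectivization K (Fin m → K))) : ℕ :=
  sSup {k | ∃ φ : Module.Dual K (Fin m → K), φ ≠ 0 ∧
    k = (Γ.filter fun P => φ P.rep = 0).card}

/-- the minimum distance `d(Γ) = |Γ| - hyp(Γ)`. -/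
def minDist {m : ℕ} (Γ : Finset (Projectivization K (Fin m → K))) : ℕ :=
  Γ.card - hyp Γ

/-- `Γ` is non-degenerate: it is not contained in any hyperplane. -/
def Nondeg {m : ℕ} (Γ : Finset (Projectivization K (Fin m → K))) : Prop :=
  ∀ φ : Module.Dual K (Fin m → K), (∀ P ∈ Γ, φ P.rep = 0) → φ = 0

/-- The higher minimum distance `d(Γ)ₐ = |Γ| - max{|Γ'| : Γ' ⊆ Γ, dim I(Γ')ₐ > dim I(Γ)ₐ}`. -/
def higherD {m : ℕ} (Γ : Finset (Projectivization K (Fin m → K))) (a : ℕ) : ℕ :=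
  Γ.card - sSup {k | ∃ Γ' ⊆ Γ,
    hdim (vanishingIdeal (Γ' : Set (Projectivization K (Fin m → K)))) a >
      hdim (vanishingIdeal (Γ : Set (Projectivization K (Fin m → K)))) a ∧ k = Γ'.card}

open Classical in
/-- The degree `δ(P)` of a point `P` in `Γ`: the least degree in which the ideal
of `Γ \ {P}` is strictly bigger than the ideal of `Γ`. -/
def pointDegree {m : ℕ} (Γ : Finset (Projectivization K (Fin m → K)))
    (P : Projectivization K (Fin m → K)) : ℕ :=
  sInf {d | hdim (vanishingIdeal ((Γ.erase P) : Set (Projectivization K (Fin m → K)))) d >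
    hdim (vanishingIdeal (Γ : Set (Projectivization K (Fin m → K)))) d}

/-- A graded minimal free resolution
`0 → F_len → ⋯ → F_1 → R → R/I → 0` of `R/I`, `R = K[x_0,…,x_{N-1}]`.
`F_j = ⊕_{i : Fin (rk j)} R(-(twist j i))` for `1 ≤ j ≤ len`.
The differential `F_1 → R` is given by `gen` (so that its image is `I`) and the
differential `F_{j+2} → F_{j+1}` is given (in matrix form, rows indexed by the
target) by `mat j`.  All entries are homogeneous of the appropriate degrees, and
minimality means all entries lie in the irrelevant maximal ideal
(zero constant coefficient). -/
structure MinFreeRes (N : ℕ) (K : Type) [Field K] (I : Ideal (MvPolynomial (Fin N) K)) where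
  len : ℕ
  rk : ℕ → ℕ
  twist : (j : ℕ) → Fin (rk j) → ℕ
  gen : Fin (rk 1) → MvPolynomial (Fin N) K
  mat : (j : ℕ) → Matrix (Fin (rk (j + 1))) (Fin (rk (j + 2))) (MvPolynomial (Fin N) K)
  rk_len_pos : 0 < rk len
  rk_eq_zero : ∀ j, len < j → rk j = 0
  gen_hom : ∀ i, (gen i).IsHomogeneous (twist 1 i)
  gen_min : ∀ i, constantCoeff (gen i) = 0
  gen_span : Ideal.span (Set.range gen) = I
  mat_hom : ∀ j i i', mat j i i' = 0 ∨
    ∃ d, (mat j i i').IsHomogeneous d ∧ d + twist (j + 1) i = twist (j + 2) i'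
  mat_min : ∀ j i i', constantCoeff (mat j i i') = 0
  exact_one : ∀ v : Fin (rk 1) → MvPolynomial (Fin N) K,
    (∑ i, v i * gen i = 0) ↔ v ∈ LinearMap.range (mat 0).mulVecLin
  exact_rest : ∀ j, LinearMap.ker (mat j).mulVecLin = LinearMap.range (mat (j + 1)).mulVecLin

/-- `a(Γ)`: the minimal twist `min_i {a_i}` occurring in the last module
`F_len = ⊕ R(-a_i)` of the minimal free resolution. -/
def MinFreeRes.aMin {N : ℕ} {K : Type} [Field K] {I : Ideal (MvPolynomial (Fin N) K)}
    (res : MinFreeRes N K I) : ℕ :=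
  Finset.univ.inf'
    (Finset.univ_nonempty_iff.mpr (Fin.pos_iff_nonempty.mp res.rk_len_pos))
    (fun i => res.twist res.len i)

/-- The minimum socle degree `A_n = min_i {a_i - n}` (here `n = len`, the length of
the resolution). -/
def MinFreeRes.A {N : ℕ} {K : Type} [Field K] {I : Ideal (MvPolynomial (Fin N) K)}
    (res : MinFreeRes N K I) : ℤ :=
  (res.aMin : ℤ) - res.len


/-- Embedding of points of `P^{m-1}` into the hyperplane `x_0 = 0` of `P^m`. -/
def embedPt {m : ℕ} (P : Projectivization K (Fin m → K)) :
    Projectivization K (Fin (m + 1) → K) :=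
  Projectivization.mk K (Fin.cons 0 P.rep) (by
    intro h
    apply P.rep_nonzero
    funext i
    simpa using congrFun h i.succ)

/-- The point `[1, c, 1, …, 1]` of `P^n` (a point on a line avoiding `x_0 = 0`). -/
def linePt (n : ℕ) (c : K) : Projectivization K (Fin (n + 1) → K) :=
  Projectivization.mk K (fun j => if (j : ℕ) = 1 then c else 1) (by
    intro h
    have h0 := congrFun h 0
    simp at h0)

open Classical in
/-- The set `Γ = Γ₁ ∪ Γ₂` of the Migliore construction: a set `Γ₀` of points of
`P^{n-1}` embedded into the hyperplane `x_0 = 0`, together with the points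
`[1, u_i, 1, …, 1]` on a line. -/
def MigGamma {n : ℕ} (Γ₀ : Finset (Projectivization K (Fin n → K)))
    {β : ℕ} (u : Fin β → K) : Finset (Projectivization K (Fin (n + 1) → K)) :=
  Γ₀.image embedPt ∪ Finset.univ.image (fun i => linePt n (u i))

/-- The ideal `I₁ = ⟨x_0, J⟩ ⊆ R = K[x_0, …, x_n]`, where
`J ⊆ S = K[x_1, …, x_n]` (vars of `S` indexed by `Fin n`, with `X i` of `S`
corresponding to `x_{i+1}` of `R`). -/
def I1 {n : ℕ} (J : Ideal (MvPolynomial (Fin n) K)) :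
    Ideal (MvPolynomial (Fin (n + 1)) K) :=
  Ideal.span {X 0} ⊔ Ideal.map (rename (Fin.succ : Fin n → Fin (n + 1))) J

/-- The polynomial `∏_{i=1}^β (u_i x_0 - x_1)`. -/
def prodPoly (n β : ℕ) (u : Fin β → K) : MvPolynomial (Fin (n + 1)) K :=
  ∏ i : Fin β, (C (u i) * X 0 - X 1)

/-- The ideal `I₂ = ⟨∏ (u_i x_0 - x_1), x_2 - x_0, …, x_n - x_0⟩` of the `β`
points `[1, u_i, 1, …, 1]` on a line. -/
def I2 (n β : ℕ) (u : Fin β → K) : Ideal (MvPolynomial (Fin (n + 1)) K) :=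
  Ideal.span ({prodPoly n β u} ∪
    {f | ∃ j : Fin (n + 1), 2 ≤ (j : ℕ) ∧ f = X j - X 0})

/-- The sequence `x_0, x_1^t, x_2, …, x_n`. -/
def ciList (K : Type) [Field K] (n t : ℕ) : List (MvPolynomial (Fin (n + 1)) K) :=
  X 0 :: X 1 ^ t :: ((List.finRange (n + 1)).drop 2).map X

/-- The complete intersection ideal `⟨x_0, x_1^t, x_2, …, x_n⟩`. -/
def CIdeal (K : Type) [Field K] (n t : ℕ) : Ideal (MvPolynomial (Fin (n + 1)) K) :=
  Ideal.span {f | f ∈ ciList K n t}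

/-- The set `𝒜 = {x_0(x_2 - x_0), …, x_0(x_n - x_0), x_0·∏(u_i x_0 - x_1)}`. -/
def calA (n β : ℕ) (u : Fin β → K) : Set (MvPolynomial (Fin (n + 1)) K) :=
  {f | ∃ j : Fin (n + 1), 2 ≤ (j : ℕ) ∧ f = X 0 * (X j - X 0)} ∪
    {X 0 * prodPoly n β u}


section Abstract
variable {R : Type} [CommRing R] (N : ℕ → Type) [∀ j, AddCommGroup (N j)] [∀ j, Module R (N j)]

structure ChaseData (n : ℕ) where
  d : ∀ j, N (j+1) →ₗ[R] N j
  dd : ∀ j x, d j (d (j+1) x) = 0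
  θ : ℕ → R
  Q : ℕ → ∀ j, Submodule R (N j)
  Q0 : ∀ j, Q 0 j = ⊥
  Qs : ∀ k j f, f ∈ Q (k+1) j ↔ ∃ y, f - θ k • y ∈ Q k j
  Qd : ∀ k j f, f ∈ Q k (j+1) → d j f ∈ Q k j
  C : ∀ k j f, k ≤ n → θ k • f ∈ Q k j → f ∈ Q k j
  p : ℕ → ∀ j, N j →+ N j
  pp : ∀ e j x, p e j (p e j x) = p e j x
  pd : ∀ e j x, p e j (d j x) = d j (p e (j+1) x)
  pθ : ∀ e j k x, p (e+1) j (θ k • x) = θ k • p e j x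
  pQ : ∀ e k j x, x ∈ Q k j → p e j x ∈ Q k j
  ex0 : ∀ j (f : N (j+2)), d (j+1) f = 0 → ∃ g, f = d (j+2) g
  ex1 : ∀ (f : N 2), d 1 f ∈ Q 1 1 → ∃ g, f - d 2 g ∈ Q 1 2

namespace ChaseData
variable {N} {n : ℕ} (D : ChaseData (R := R) N n)

lemma mono (k j f) (h : f ∈ D.Q k j) : f ∈ D.Q (k+1) j := by
  rw [D.Qs]; exact ⟨0, by simpa using h⟩

lemma θmem (k j) (f : N j) : D.θ k • f ∈ D.Q (k+1) j := by
  rw [D.Qs]; exact ⟨f, by simp⟩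

def E (k j : ℕ) : Prop := ∀ f : N (j+1), D.d j f ∈ D.Q k j → ∃ g, f - D.d (j+1) g ∈ D.Q k (j+1)

lemma E_step (k j) (hk : k ≤ n) (h1 : D.E k (j+1)) (h0 : D.E k j) : D.E (k+1) (j+1) := by
  intro f hf
  obtain ⟨y, hy⟩ := (D.Qs _ _ _).1 hf
  have h := D.Qd _ _ _ hy
  rw [map_sub, D.dd, zero_sub, Submodule.neg_mem_iff, map_smul] at h
  obtain ⟨g, hg⟩ := h0 y (D.C _ _ _ hk h)
  obtain ⟨h', hh⟩ := h1 (f - D.θ k • g) (by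
    have := (D.Q k (j+1)).add_mem hy ((D.Q k (j+1)).smul_mem (D.θ k) hg)
    convert this using 1
    rw [map_sub, map_smul, smul_sub]; abel)
  refine ⟨h', (D.Qs _ _ _).2 ⟨g, ?_⟩⟩
  convert hh using 1; abel

lemma E_all (k j) (hk : k ≤ n) (hkj : k ≤ j) : D.E (k+1) (j+1) := by
  have h0 : ∀ j, D.E 0 (j+1) := by
    intro j f hf
    rw [D.Q0, Submodule.mem_bot] at hf
    obtain ⟨g, hg⟩ := D.ex0 j f hf
    exact ⟨g, by rw [D.Q0, Submodule.mem_bot, ← hg, sub_self]⟩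
  induction k generalizing j with
  | zero =>
    cases j with
    | zero => exact D.ex1
    | succ j => exact D.E_step _ _ hk (h0 _) (h0 _)
  | succ k ih =>
    obtain ⟨j, rfl⟩ : ∃ i, j = i+1 := ⟨j-1, by omega⟩
    exact D.E_step _ _ hk (ih _ (by omega) (by omega)) (ih _ (by omega) (by omega))

def B (k : ℕ) : Submodule R (N (k+1)) := D.Q (k+1) (k+1) ⊔ LinearMap.range (D.d (k+1))

lemma mem_B (k f) : f ∈ D.B k ↔ ∃ g, f - D.d (k+1) g ∈ D.Q (k+1) (k+1) := by
  rw [B, Submodule.mem_sup]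
  constructor
  · rintro ⟨a, ha, _, ⟨g, rfl⟩, rfl⟩; exact ⟨g, by simpa using ha⟩
  · rintro ⟨g, hg⟩; exact ⟨_, hg, _, ⟨g, rfl⟩, by simp⟩

/-- homogeneous socle class in degree `e + k`. -/
def W (k e : ℕ) : Prop := ∃ f : N (k+1), D.p (e+k) _ f = f ∧ D.d k f ∈ D.Q (k+1) k ∧
  f ∉ D.B k ∧ ∀ i, k+1 ≤ i → i ≤ n → D.θ i • f ∈ D.B k

lemma up (k e) (hk : k+1 ≤ n) (h : D.W (k+1) e) : D.W k e := by
  obtain ⟨f, fp, fd, fB, fs⟩ := h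
  obtain ⟨y, hy⟩ := (D.Qs _ _ _).1 fd
  have hy' := D.pQ (e+k+1) _ _ _ hy
  rw [map_sub, D.pd, D.pθ, show e+k+1 = e+(k+1) by ring, fp] at hy'
  set z := D.p (e+k) (k+1) y with hz
  have hEk := D.E_all k k (by omega) le_rfl
  refine ⟨z, D.pp _ _ _, ?_, ?_, ?_⟩
  · have h := D.Qd _ _ _ hy'
    rw [map_sub, D.dd, zero_sub, Submodule.neg_mem_iff, map_smul] at h
    exact D.C _ _ _ hk h
  · intro hB
    obtain ⟨g, hg⟩ := (D.mem_B _ _).1 hB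
    apply fB
    obtain ⟨h', hh⟩ := hEk (f - D.θ (k+1) • g) (by
      have := (D.Q (k+1) (k+1)).add_mem hy' ((D.Q (k+1) (k+1)).smul_mem (D.θ (k+1)) hg)
      convert this using 1
      rw [map_sub, map_smul, smul_sub]; abel)
    rw [mem_B]
    refine ⟨h', (D.Qs _ _ _).2 ⟨g, ?_⟩⟩
    convert hh using 1; abel
  · intro i hi hin
    rcases Nat.eq_or_lt_of_le hi with rfl | hi
    · rw [mem_B]
      refine ⟨f, ?_⟩
      rw [← Submodule.neg_mem_iff]; convert hy' using 1; abel
    · obtain ⟨h', hh⟩ := (D.mem_B _ _).1 (fs i hi hin)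
      obtain ⟨g, hg⟩ := (D.Qs _ _ _).1 hh
      have h := D.Qd _ _ _ hg
      rw [map_sub, map_sub, D.dd, sub_zero, map_smul, map_smul] at h
      rw [mem_B]
      refine ⟨g, D.C _ _ _ hk ?_⟩
      have := (D.Q (k+1) (k+1)).sub_mem h ((D.Q (k+1) (k+1)).smul_mem (D.θ i) hy')
      convert this using 1
      rw [smul_sub, smul_sub, smul_comm]; abel

lemma down (k e) (hk : k+1 ≤ n) (h : D.W k e) : D.W (k+1) e := by
  obtain ⟨y, yp, yd, yB, ys⟩ := h
  have hEk := D.E_all k k (by omega) le_rfl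
  obtain ⟨f₀, hf₀⟩ := (D.mem_B _ _).1 (ys (k+1) le_rfl hk)
  have hf := D.pQ (e+k+1) _ _ _ hf₀
  rw [map_sub, D.pd, D.pθ, yp] at hf
  set f := D.p (e+k+1) (k+1+1) f₀
  refine ⟨f, D.pp _ _ _, ?_, ?_, ?_⟩
  · rw [D.Qs]
    refine ⟨y, ?_⟩
    rw [← Submodule.neg_mem_iff]; convert hf using 1; abel
  · intro hB
    obtain ⟨h', hh⟩ := (D.mem_B _ _).1 hB
    obtain ⟨g, hg⟩ := (D.Qs _ _ _).1 hh
    have h := D.Qd _ _ _ hg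
    rw [map_sub, map_sub, D.dd, sub_zero, map_smul] at h
    apply yB
    rw [mem_B]
    refine ⟨g, D.C _ _ _ hk ?_⟩
    have := (D.Q (k+1) (k+1)).add_mem h hf
    convert this using 1
    rw [smul_sub]; abel
  · intro i hi hin
    obtain ⟨f', hf'⟩ := (D.mem_B _ _).1 (ys i (by omega) hin)
    obtain ⟨h', hh⟩ := hEk (D.θ i • f - D.θ (k+1) • f') (by
      have := (D.Q (k+1) (k+1)).sub_mem ((D.Q (k+1) (k+1)).smul_mem (D.θ (k+1)) hf')
        ((D.Q (k+1) (k+1)).smul_mem (D.θ i) hf)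
      convert this using 1
      rw [map_sub, map_smul, map_smul, smul_sub, smul_sub, smul_comm]; abel)
    rw [mem_B]
    refine ⟨h', (D.Qs _ _ _).2 ⟨f', ?_⟩⟩
    convert hh using 1; abel

lemma W_iff (k e) (hk : k ≤ n) : D.W k e ↔ D.W 0 e := by
  induction k with
  | zero => rfl
  | succ k ih => rw [← ih (by omega)]; exact ⟨D.up _ _ hk, D.down _ _ hk⟩

end ChaseData
end Abstract
section AlgLemmas
variable {K : Type} [Field K]

lemma hc_mul_of_le {σ : Type} {a b : MvPolynomial σ K} {i e : ℕ} (ha : a.IsHomogeneous i)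
    (h : i ≤ e) : homogeneousComponent e (a * b) = a * homogeneousComponent (e - i) b := by
  let _ := MvPolynomial.gradedAlgebra (σ := σ) (R := K)
  have := DirectSum.coe_decompose_mul_of_left_mem_of_le (homogeneousSubmodule σ K) (a := a) (b := b)
    (n := e) (i := i) ha h
  rw [← decomposition.decompose'_apply, ← decomposition.decompose'_apply]
  exact this

lemma hc_mul_of_lt {σ : Type} {a b : MvPolynomial σ K} {i e : ℕ} (ha : a.IsHomogeneous i)
    (h : e < i) : homogeneousComponent e (a * b) = 0 := by
  let _ := MvPolynomial.gradedAlgebra (σ := σ) (R := K)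
  have := DirectSum.coe_decompose_mul_of_left_mem_of_not_le (homogeneousSubmodule σ K) (a := a)
    (b := b) (n := e) (i := i) ha (by omega)
  rw [← decomposition.decompose'_apply]
  exact this

lemma hc_mem_span {σ : Type} (S : Set (MvPolynomial σ K))
    (hS : ∀ f ∈ S, ∃ d, f.IsHomogeneous d) {f : MvPolynomial σ K} (hf : f ∈ Ideal.span S) (e : ℕ) :
    homogeneousComponent e f ∈ Ideal.span S := by
  let _ := MvPolynomial.gradedAlgebra (σ := σ) (R := K)
  refine homogeneousComponent_mem_of_mem (Ideal.homogeneous_span _ _ ?_) hf e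
  intro x hx
  obtain ⟨d, hd⟩ := hS x hx
  exact ⟨d, hd⟩

lemma X_cancel {N : ℕ} (k : Fin N) (f : MvPolynomial (Fin N) K)
    (h : X k * f ∈ Ideal.span (X '' {i : Fin N | i < k} : Set (MvPolynomial (Fin N) K))) :
    f ∈ Ideal.span (X '' {i : Fin N | i < k} : Set (MvPolynomial (Fin N) K)) := by
  rw [mem_ideal_span_X_image] at h ⊢
  intro m hm
  obtain ⟨i, hi, hi'⟩ := h (Finsupp.single k 1 + m) (by
    rw [mem_support_iff, coeff_X_mul]; exact mem_support_iff.1 hm)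
  refine ⟨i, hi, ?_⟩
  have : k ≠ i := ne_of_gt hi
  simpa [Finsupp.single_apply, this] using hi'

def qIdeal {R : Type} [CommRing R] (θ : ℕ → R) (k : ℕ) : Ideal R := Ideal.span (θ '' {i | i < k})

lemma qIdeal_zero {R : Type} [CommRing R] (θ : ℕ → R) : qIdeal θ 0 = ⊥ := by simp [qIdeal]

lemma mem_qIdeal_succ {R : Type} [CommRing R] (θ : ℕ → R) (k : ℕ) (f : R) :
    f ∈ qIdeal θ (k+1) ↔ ∃ y, f - θ k * y ∈ qIdeal θ k := by
  have : θ '' {i | i < k+1} = insert (θ k) (θ '' {i | i < k}) := by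
    rw [← Set.image_insert_eq]; congr 1; ext i; simp; omega
  rw [qIdeal, this, Ideal.mem_span_insert]
  constructor
  · rintro ⟨a, z, hz, rfl⟩; exact ⟨a, by simpa [mul_comm, qIdeal] using hz⟩
  · rintro ⟨y, hy⟩; exact ⟨y, _, hy, by ring⟩

lemma inj_of_surj_endo {A : Type} [CommRing A] [IsNoetherianRing A] (ρ : A →+* A)
    (h : Function.Surjective ρ) : Function.Injective ρ := by
  have hz : ∀ i, ρ^[i] 0 = 0 := fun i => by
    induction i with
    | zero => rfl
    | succ i ih => rw [Function.iterate_succ_apply, map_zero, ih]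
  have key : ∀ i x, ρ^[i] x = 0 ↔ x ∈ (Nat.rec ⊥ (fun _ I => Ideal.comap ρ I) i : Ideal A) := by
    intro i
    induction i with
    | zero => intro x; simp
    | succ i ih => intro x; rw [Function.iterate_succ_apply, ih]; rfl
  let F : ℕ →o Submodule A A := ⟨fun i => (Nat.rec ⊥ (fun _ I => Ideal.comap ρ I) i : Ideal A),
    by
      refine monotone_nat_of_le_succ ?_
      intro i x hx
      replace hx := (key i x).2 hx
      refine (key (i+1) x).1 ?_
      rw [Function.iterate_succ_apply', hx, map_zero]⟩
  obtain ⟨m, hm⟩ := monotone_stabilizes_iff_noetherian.mpr (inferInstanceAs (IsNoetherian A A)) F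
  rw [injective_iff_map_eq_zero]
  intro x hx
  obtain ⟨y, rfl⟩ := h.iterate m x
  have h1 : y ∈ F (m+1) := (key (m+1) y).1 (by rw [Function.iterate_succ_apply']; exact hx)
  rw [← hm (m+1) (by omega)] at h1
  exact (key m y).2 h1

lemma q_cancel {N : ℕ} (θ : ℕ → MvPolynomial (Fin N) K)
    (hsurj : Function.Surjective (aeval (R := K) (fun i : Fin N => θ i)))
    (k : ℕ) (hk : k < N) (f) (h : θ k * f ∈ qIdeal θ k) : f ∈ qIdeal θ k := by
  set ρ := aeval (R := K) (fun i : Fin N => θ i) with hρ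
  have hinj : Function.Injective ρ :=
    inj_of_surj_endo ρ.toRingHom hsurj
  let e := AlgEquiv.ofBijective ρ ⟨hinj, hsurj⟩
  have hq : qIdeal θ k = Ideal.map e
      (Ideal.span (X '' {i : Fin N | i < ⟨k, hk⟩} : Set (MvPolynomial (Fin N) K))) := by
    rw [Ideal.map_span, qIdeal, Set.image_image]
    congr 1
    ext x
    constructor
    · rintro ⟨i, hi, rfl⟩
      exact ⟨⟨i, by simp at hi; omega⟩, hi, by simp [e, ρ]⟩
    · rintro ⟨i, hi, rfl⟩
      exact ⟨i, hi, by simp [e, ρ]⟩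
  obtain ⟨g, rfl⟩ := hsurj f
  have hk' : θ k = ρ (X ⟨k, hk⟩) := by simp [ρ]
  rw [hq] at h ⊢
  rw [hk', ← map_mul] at h
  have key : ∀ x (I : Ideal (MvPolynomial (Fin N) K)), ρ x ∈ Ideal.map e I ↔ x ∈ I := by
    intro x I
    rw [Ideal.mem_map_of_equiv]
    constructor
    · rintro ⟨y, hy, hxy⟩; rwa [← hinj hxy]
    · intro hx; exact ⟨x, hx, rfl⟩
  rw [key] at h ⊢
  exact X_cancel _ _ h

lemma finrank_hom (m d : ℕ) : Module.finrank K (homogeneousSubmodule (Fin m) K d) =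
    (m + d - 1).choose d := by
  rw [homogeneousSubmodule_eq_finsupp_supported]
  rw [(AddMonoidAlgebra.supportedEquivFinsupp (S := K) (R := K)
    {x : Fin m →₀ ℕ | x.degree = d}).finrank_eq]
  have : {x : Fin m →₀ ℕ | x.degree = d} = (Finset.univ.finsuppAntidiag d : Finset (Fin m →₀ ℕ)) := by
    ext x; simp [Finsupp.degree_eq_sum]
  rw [this]
  have h2 := Finset.card_finsuppAntidiag_nat_eq_choose (s := (Finset.univ : Finset (Fin m))) d
  rw [Finset.card_univ, Fintype.card_fin] at h2
  rw [← h2, Module.finrank_finsupp_self]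
  simp

end AlgLemmas
section Concrete
variable {K : Type} [Field K]

def prj {N r : ℕ} (a : Fin r → ℕ) (e : ℕ) :
    (Fin r → MvPolynomial (Fin N) K) →+ (Fin r → MvPolynomial (Fin N) K) where
  toFun f i := if a i ≤ e then homogeneousComponent (e - a i) (f i) else 0
  map_zero' := by ext1 i; simp
  map_add' f g := by ext1 i; by_cases h : a i ≤ e <;> simp [h]

lemma prj_apply {N r : ℕ} (a : Fin r → ℕ) (e : ℕ) (f : Fin r → MvPolynomial (Fin N) K) (i) :
    prj a e f i = if a i ≤ e then homogeneousComponent (e - a i) (f i) else 0 := rfl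

lemma prj_prj {N r : ℕ} (a : Fin r → ℕ) (e : ℕ) (f : Fin r → MvPolynomial (Fin N) K) :
    prj a e (prj a e f) = prj a e f := by
  ext1 i
  rw [prj_apply, prj_apply]
  split_ifs
  · exact homogeneousComponent_eq_self (homogeneousComponent_isHomogeneous _ _)
  · rfl

lemma prj_smul {N r : ℕ} (a : Fin r → ℕ) (e : ℕ) (t : MvPolynomial (Fin N) K)
    (ht : t.IsHomogeneous 1) (f : Fin r → MvPolynomial (Fin N) K) :
    prj a (e+1) (t • f) = t • prj a e f := by
  ext1 i
  rw [prj_apply, Pi.smul_apply, Pi.smul_apply, prj_apply, smul_eq_mul, smul_eq_mul]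
  by_cases h : a i ≤ e
  · rw [if_pos h, if_pos (by omega), hc_mul_of_le ht (by omega)]
    rw [show e + 1 - a i - 1 = e - a i by omega]
  · rw [if_neg h, mul_zero]
    split_ifs with h'
    · exact hc_mul_of_lt ht (by omega)
    · rfl

lemma prj_mat {N r r' : ℕ} (a : Fin r → ℕ) (a' : Fin r' → ℕ) (e : ℕ)
    (m : Matrix (Fin r) (Fin r') (MvPolynomial (Fin N) K))
    (hm : ∀ i i', m i i' = 0 ∨ ∃ d, (m i i').IsHomogeneous d ∧ d + a i = a' i')
    (f : Fin r' → MvPolynomial (Fin N) K) :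
    prj a e (m.mulVec f) = m.mulVec (prj a' e f) := by
  ext1 i
  rw [prj_apply]
  simp only [Matrix.mulVec, dotProduct, prj_apply, map_sum]
  have key : ∀ i', (if a i ≤ e then homogeneousComponent (e - a i) (m i i' * f i') else 0) =
      m i i' * (if a' i' ≤ e then homogeneousComponent (e - a' i') (f i') else 0) := by
    intro i'
    rcases hm i i' with h | ⟨d, hd, hda⟩
    · simp [h]
    · by_cases h' : a' i' ≤ e
      · rw [if_pos h', if_pos (by omega), hc_mul_of_le hd (by omega)]
        rw [show e - a i - d = e - a' i' by omega]
      · rw [if_neg h', mul_zero]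
        split_ifs with h
        · exact hc_mul_of_lt hd (by omega)
        · rfl
  rw [← Finset.sum_congr rfl (fun i' _ => key i')]
  split_ifs <;> simp

/-- vectors with all entries in an ideal -/
def vecIn {R : Type} [CommRing R] (r : ℕ) (I : Ideal R) : Submodule R (Fin r → R) where
  carrier := {f | ∀ i, f i ∈ I}
  zero_mem' := fun i => I.zero_mem
  add_mem' := fun hf hg i => I.add_mem (hf i) (hg i)
  smul_mem' := fun c _ hf i => I.mul_mem_left c (hf i)

lemma mem_vecIn {R : Type} [CommRing R] (r : ℕ) (I : Ideal R) (f : Fin r → R) :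
    f ∈ vecIn r I ↔ ∀ i, f i ∈ I := Iff.rfl

variable {N : ℕ} {I : Ideal (MvPolynomial (Fin N) K)} (res : MinFreeRes N K I)

def rk' : ℕ → ℕ
  | 0 => 0
  | 1 => 1
  | j+2 => res.rk (j+1)

def tw' : (j : ℕ) → Fin (rk' res j) → ℕ
  | 0 => fun _ => 0
  | 1 => fun _ => 0
  | j+2 => res.twist (j+1)

def mt' : (j : ℕ) → Matrix (Fin (rk' res j)) (Fin (rk' res (j+1))) (MvPolynomial (Fin N) K)
  | 0 => 0
  | 1 => fun _ i => res.gen i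
  | j+2 => res.mat j

lemma mt'_hom (j i i') : mt' res j i i' = 0 ∨
    ∃ d, (mt' res j i i').IsHomogeneous d ∧ d + tw' res j i = tw' res (j+1) i' := by
  match j, i, i' with
  | 0, _, _ => exact Or.inl rfl
  | 1, _, i' => exact Or.inr ⟨_, res.gen_hom i', rfl⟩
  | j+2, i, i' => exact res.mat_hom j i i'

lemma mt1_apply (f : Fin (rk' res 2) → MvPolynomial (Fin N) K) (i) :
    (mt' res 1).mulVec f i = ∑ k : Fin (res.rk 1), f k * res.gen k := by
  simp only [Matrix.mulVec, dotProduct]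
  exact Finset.sum_congr rfl fun k _ => mul_comm _ _

lemma mem_I_iff (y) : y ∈ I ↔ ∃ f : Fin (rk' res 2) → MvPolynomial (Fin N) K,
    (mt' res 1).mulVec f = fun _ => y := by
  conv_lhs => rw [← res.gen_span]
  rw [Ideal.mem_span_range_iff_exists_fun]
  constructor
  · rintro ⟨c, hc⟩
    exact ⟨c, by ext1 i; exact (mt1_apply res c i).trans hc⟩
  · rintro ⟨c, hc⟩
    refine ⟨c, ?_⟩
    have := congrFun hc (0 : Fin 1)
    exact (mt1_apply res c _).symm.trans this

def chase (n : ℕ) (θ : ℕ → MvPolynomial (Fin N) K) (hθ : ∀ k, (θ k).IsHomogeneous 1)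
    (hC : ∀ k ≤ n, ∀ f, θ k * f ∈ qIdeal θ k → f ∈ qIdeal θ k)
    (hI : ∀ f, θ 0 * f ∈ I → f ∈ I) :
    ChaseData (R := MvPolynomial (Fin N) K)
      (fun j => Fin (rk' res j) → MvPolynomial (Fin N) K) n where
  d j := (mt' res j).mulVecLin
  dd j x := by
    match j, x with
    | 0, x => ext1 i; exact i.elim0
    | 1, x =>
      ext1 i
      rw [Matrix.mulVecLin_apply, mt1_apply]
      exact (res.exact_one _).2 ⟨x, rfl⟩
    | j+2, x =>
      have : (res.mat (j+1)).mulVecLin x ∈ LinearMap.ker (res.mat j).mulVecLin := by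
        rw [res.exact_rest]; exact ⟨x, rfl⟩
      exact this
  θ := θ
  Q k j := vecIn _ (qIdeal θ k)
  Q0 j := by
    rw [qIdeal_zero]; ext f; rw [mem_vecIn, Submodule.mem_bot]
    simp [funext_iff]
  Qs k j f := by
    simp only [mem_vecIn, mem_qIdeal_succ]
    constructor
    · intro h; choose y hy using h; exact ⟨y, hy⟩
    · rintro ⟨y, hy⟩ i; exact ⟨y i, hy i⟩
  Qd k j f hf i := by
    rw [Matrix.mulVecLin_apply, Matrix.mulVec, dotProduct]
    exact Ideal.sum_mem _ fun k _ => Ideal.mul_mem_left _ _ (hf k)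
  C k j f hk hf i := hC k hk _ (hf i)
  p e j := prj (tw' res j) e
  pp e j x := prj_prj _ _ _
  pd e j x := prj_mat _ _ _ _ (mt'_hom res j) _
  pθ e j k x := prj_smul _ _ _ (hθ k) _
  pQ e k j x hx i := by
    rw [prj_apply]
    split_ifs
    · refine hc_mem_span _ ?_ (hx i) _
      rintro _ ⟨k, _, rfl⟩; exact ⟨1, hθ k⟩
    · exact Ideal.zero_mem _
  ex0 j f hf := by
    match j, f, hf with
    | 0, f, hf =>
      have := (res.exact_one f).1 (by
        have := congrFun hf (0 : Fin 1)
        rw [Matrix.mulVecLin_apply] at this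
        erw [mt1_apply] at this
        exact this)
      obtain ⟨g, hg⟩ := this
      exact ⟨g, hg.symm⟩
    | j+1, f, hf =>
      have : f ∈ LinearMap.ker (res.mat j).mulVecLin := hf
      rw [res.exact_rest] at this
      obtain ⟨g, hg⟩ := this
      exact ⟨g, hg.symm⟩
  ex1 f hf := by
    have h0 := hf (0 : Fin 1)
    rw [mem_qIdeal_succ] at h0
    obtain ⟨y, hy⟩ := h0
    rw [qIdeal_zero, Ideal.mem_bot, sub_eq_zero] at hy
    have hyI : y ∈ I := by
      apply hI
      rw [← hy, mem_I_iff res]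
      refine ⟨f, ?_⟩
      ext1 i
      obtain rfl : i = (0 : Fin 1) := Subsingleton.elim (α := Fin 1) _ _
      rfl
    obtain ⟨g, hg⟩ := (mem_I_iff res y).1 hyI
    have hz : (mt' res 1).mulVec (f - θ 0 • g) = 0 := by
      rw [Matrix.mulVec_sub, Matrix.mulVec_smul, hg]
      ext1 i
      obtain rfl : i = (0 : Fin 1) := Subsingleton.elim (α := Fin 1) _ _
      exact sub_eq_zero.2 hy
    have := (res.exact_one (f - θ 0 • g)).1 (by
        have := congrFun hz (0 : Fin 1)
        erw [mt1_apply] at this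
        exact this)
    obtain ⟨h, hh⟩ := this
    refine ⟨h, ?_⟩
    intro i
    rw [mem_qIdeal_succ]
    refine ⟨g i, ?_⟩
    rw [qIdeal_zero, Ideal.mem_bot, sub_eq_zero]
    have hh' := congrFun hh i
    change f i - (res.mat 0).mulVecLin h i = _
    rw [hh']
    simp

end Concrete
section Socle
variable {K : Type} [Field K] {N : ℕ} {I : Ideal (MvPolynomial (Fin N) K)} (res : MinFreeRes N K I)
variable (n : ℕ) (θ : ℕ → MvPolynomial (Fin N) K) (hθ : ∀ k, (θ k).IsHomogeneous 1)
    (hC : ∀ k ≤ n, ∀ f, θ k * f ∈ qIdeal θ k → f ∈ qIdeal θ k)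
    (hI : ∀ f, θ 0 * f ∈ I → f ∈ I)

lemma mem_B0 (f) : f ∈ (chase res n θ hθ hC hI).B 0 ↔
    f (0 : Fin 1) ∈ I ⊔ Ideal.span {θ 0} := by
  rw [ChaseData.mem_B, Submodule.mem_sup]
  constructor
  · rintro ⟨g, hg⟩
    have h0 := hg (0 : Fin 1)
    rw [mem_qIdeal_succ] at h0
    obtain ⟨y, hy⟩ := h0
    rw [qIdeal_zero, Ideal.mem_bot, sub_eq_zero] at hy
    refine ⟨(mt' res 1).mulVec g (0 : Fin 1), ?_, θ 0 * y,
      Ideal.mul_mem_right _ _ (Ideal.mem_span_singleton_self _), ?_⟩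
    · rw [mem_I_iff res]
      refine ⟨g, ?_⟩
      ext1 i
      obtain rfl : i = (0 : Fin 1) := Subsingleton.elim (α := Fin 1) _ _
      rfl
    · rw [← hy]
      change (mt' res 1).mulVec g (0 : Fin 1) + (f (0 : Fin 1) - (mt' res 1).mulVec g (0 : Fin 1)) = _
      abel
  · rintro ⟨a, ha, b, hb, hab⟩
    obtain ⟨g, hg⟩ := (mem_I_iff res a).1 ha
    obtain ⟨y, rfl⟩ := Ideal.mem_span_singleton'.1 hb
    refine ⟨g, ?_⟩
    intro i
    obtain rfl : i = (0 : Fin 1) := Subsingleton.elim (α := Fin 1) _ _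
    apply (mem_qIdeal_succ θ 0 _).2
    refine ⟨y, ?_⟩
    rw [qIdeal_zero, Ideal.mem_bot, sub_eq_zero]
    change f (0 : Fin 1) - (mt' res 1).mulVec g (0 : Fin 1) = _
    rw [hg, ← hab]
    ring

lemma mt'_min (j i i') : constantCoeff (mt' res j i i') = 0 := by
  match j, i, i' with
  | 0, i, i' => exact map_zero _
  | 1, i, i' => exact res.gen_min i'
  | j+2, i, i' => exact res.mat_min j i i'

lemma mt'_mulVec_min (j f k) : constantCoeff ((mt' res j).mulVec f k) = 0 := by
  rw [Matrix.mulVec, dotProduct, map_sum]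
  refine Finset.sum_eq_zero fun l _ => ?_
  rw [map_mul, mt'_min, zero_mul]

lemma W0_iff (e : ℕ) : (chase res n θ hθ hC hI).W 0 e ↔ ∃ b : MvPolynomial (Fin N) K,
    b.IsHomogeneous e ∧ b ∉ I ⊔ Ideal.span {θ 0} ∧
      ∀ i, 1 ≤ i → i ≤ n → θ i * b ∈ I ⊔ Ideal.span {θ 0} := by
  constructor
  · rintro ⟨f, fp, -, fB, fs⟩
    refine ⟨f (0 : Fin 1), ?_, ?_, ?_⟩
    · have := congrFun fp (0 : Fin 1)
      rw [← this]
      exact homogeneousComponent_isHomogeneous _ _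
    · rwa [mem_B0] at fB
    · intro i hi hin
      have := fs i hi hin
      rwa [mem_B0] at this
  · rintro ⟨b, bh, bI, bs⟩
    refine ⟨fun _ => b, ?_, ?_, ?_, ?_⟩
    · ext1 i
      exact homogeneousComponent_eq_self bh
    · intro i; exact i.elim0
    · rwa [mem_B0]
    · intro i hi hin
      rw [mem_B0]
      exact bs i hi hin

lemma Wn_iff (m e : ℕ) (hn : n = m+1) (hlen : res.len = n)
    (hmax : ∀ f, f ∈ qIdeal θ (n+1) ↔ constantCoeff f = 0) :
    (chase res n θ hθ hC hI).W n e ↔ ∃ i, res.twist n i = e + n := by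
  subst hn
  have hB : ∀ f, f ∈ (chase res (m+1) θ hθ hC hI).B (m+1) ↔
      ∀ i : Fin (res.rk (m+1)), constantCoeff (f i) = 0 := by
    intro f
    rw [ChaseData.mem_B]
    have hg : ∀ g, (chase res (m+1) θ hθ hC hI).d (m+1+1) g = 0 := by
      intro g
      have : g = 0 := by
        ext1 i
        have h0 : res.rk (m+1+1) = 0 := res.rk_eq_zero _ (by omega)
        exact (Fin.cast h0 i).elim0
      rw [this, map_zero]
    constructor
    · rintro ⟨g, hg'⟩ i
      rw [hg, sub_zero] at hg'
      exact (hmax _).1 (hg' i)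
    · intro h
      refine ⟨0, ?_⟩
      rw [map_zero, sub_zero]
      intro i
      exact (hmax _).2 (h i)
  constructor
  · rintro ⟨f, fp, -, fB, -⟩
    rw [hB] at fB
    push Not at fB
    obtain ⟨i, hi⟩ := fB
    refine ⟨i, ?_⟩
    have h1 : (if res.twist (m+1) i ≤ e + (m+1) then
      homogeneousComponent (e + (m+1) - res.twist (m+1) i) (f i) else 0) = f i := congrFun fp i
    by_contra hne
    apply hi
    rw [← h1]
    split_ifs with h
    · have := homogeneousComponent_isHomogeneous (e + (m+1) - res.twist (m+1) i) (f i)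
      rw [constantCoeff_eq]
      apply this.coeff_eq_zero
      simp
      omega
    · simp
  · rintro ⟨i, hi⟩
    refine ⟨(Pi.single i 1 : Fin (res.rk (m+1)) → MvPolynomial (Fin N) K), ?_, ?_, ?_, ?_⟩
    · change prj (res.twist (m+1)) _ _ = _
      ext1 k
      rw [prj_apply]
      by_cases hk : k = i
      · subst hk
        rw [if_pos (by omega), hi]
        simp [homogeneousComponent_zero]
      · simp [hk]
    · intro k
      apply (hmax _).2
      exact mt'_mulVec_min res (m+1) _ k
    · intro h
      have := (hB _).1 h i
      simp at this
    · intro k hk hk'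
      omega

lemma twist_iff (m e : ℕ) (hn : n = m+1) (hlen : res.len = n)
    (hmax : ∀ f, f ∈ qIdeal θ (n+1) ↔ constantCoeff f = 0) 
    (hθ : ∀ k, (θ k).IsHomogeneous 1)
    (hC : ∀ k ≤ n, ∀ f, θ k * f ∈ qIdeal θ k → f ∈ qIdeal θ k)
    (hI : ∀ f, θ 0 * f ∈ I → f ∈ I) :
    (∃ i, res.twist n i = e + n) ↔ ∃ b : MvPolynomial (Fin N) K,
    b.IsHomogeneous e ∧ b ∉ I ⊔ Ideal.span {θ 0} ∧
      ∀ i, 1 ≤ i → i ≤ n → θ i * b ∈ I ⊔ Ideal.span {θ 0} := by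
  rw [← Wn_iff res n θ hθ hC hI m e hn hlen hmax, ChaseData.W_iff _ _ _ le_rfl, W0_iff]

end Socle
section Theta
variable {K : Type} [Field K] {m : ℕ}

def ell (c : Fin (m+3) → K) : MvPolynomial (Fin (m+3)) K := ∑ j, C (c j) * X j

def thetas (c : Fin (m+3) → K) : ℕ → MvPolynomial (Fin (m+3)) K
  | 0 => ell c
  | 1 => X 0
  | 2 => X 1
  | k+3 => if h : k+3 < m+3 then X ⟨k+3, h⟩ else 0

lemma ell_hom (c : Fin (m+3) → K) : (ell c).IsHomogeneous 1 := by
  refine IsHomogeneous.sum _ _ _ fun j _ => ?_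
  simpa using (isHomogeneous_C _ (c j)).mul (isHomogeneous_X K j)

lemma thetas_hom (c : Fin (m+3) → K) (k) : (thetas c k).IsHomogeneous 1 := by
  match k with
  | 0 => exact ell_hom c
  | 1 => exact isHomogeneous_X K _
  | 2 => exact isHomogeneous_X K _
  | k+3 =>
    rw [thetas]
    split_ifs
    · exact isHomogeneous_X K _
    · exact isHomogeneous_zero _ _ _

lemma X_of_ne_two (c : Fin (m+3) → K) (j : Fin (m+3)) (hj : j ≠ 2) :
    ∃ k, 1 ≤ k ∧ k < m+3 ∧ thetas c k = X j := by
  obtain ⟨j, hj'⟩ := j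
  match j, hj', hj with
  | 0, _, _ => exact ⟨1, le_rfl, by omega, rfl⟩
  | 1, _, _ => exact ⟨2, by omega, by omega, rfl⟩
  | 2, _, h => exact absurd rfl h
  | k+3, h, _ => exact ⟨k+3, by omega, h, by rw [thetas, dif_pos h]⟩

lemma thetas_X (c : Fin (m+3) → K) (k) (hk : 1 ≤ k) (hk' : k < m+3) :
    ∃ j, thetas c k = X j := by
  match k, hk, hk' with
  | 1, _, _ => exact ⟨_, rfl⟩
  | 2, _, _ => exact ⟨_, rfl⟩
  | k+3, _, h => exact ⟨⟨k+3, h⟩, by rw [thetas, dif_pos h]⟩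

lemma X_two (c : Fin (m+3) → K) (hc : c 2 ≠ 0) :
    X 2 = C (c 2)⁻¹ * (thetas c 0 - ∑ j ∈ Finset.univ.erase 2, C (c j) * X j) := by
  have : thetas c 0 = C (c 2) * X 2 + ∑ j ∈ Finset.univ.erase 2, C (c j) * X j := by
    rw [Finset.add_sum_erase _ (fun j => C (c j) * X j) (Finset.mem_univ _)]; rfl
  rw [this, add_sub_cancel_right, ← mul_assoc, ← C_mul, inv_mul_cancel₀ hc, C_1, one_mul]

lemma thetas_surj (c : Fin (m+3) → K) (hc : c 2 ≠ 0) :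
    Function.Surjective (aeval (R := K) (fun i : Fin (m+3) => thetas c i)) := by
  rw [← AlgHom.range_eq_top, eq_top_iff, ← MvPolynomial.adjoin_range_X, Algebra.adjoin_le_iff]
  have hk : ∀ k < m+3, thetas c k ∈ (aeval (R := K) (fun i : Fin (m+3) => thetas c i)).range :=
    fun k hk => ⟨X ⟨k, hk⟩, by simp⟩
  have h2 : ∀ j ≠ 2, X j ∈ (aeval (R := K) (fun i : Fin (m+3) => thetas c i)).range := by
    intro j hj
    obtain ⟨k, _, hk', h⟩ := X_of_ne_two c j hj
    rw [← h]; exact hk k hk'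
  have hC : ∀ a, C a ∈ (aeval (R := K) (fun i : Fin (m+3) => thetas c i)).range :=
    fun a => Subalgebra.algebraMap_mem _ a
  rintro _ ⟨j, rfl⟩
  by_cases hj : j = 2
  · subst hj
    rw [X_two c hc]
    refine Subalgebra.mul_mem _ (hC _) (Subalgebra.sub_mem _ (hk 0 (by omega)) ?_)
    exact Subalgebra.sum_mem _ fun j hj => Subalgebra.mul_mem _ (hC _) (h2 j (Finset.ne_of_mem_erase hj))
  · exact h2 j hj

lemma thetas_max (c : Fin (m+3) → K) (hc : c 2 ≠ 0) (f) :
    f ∈ qIdeal (thetas c) (m+3) ↔ constantCoeff f = 0 := by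
  constructor
  · intro h
    have : qIdeal (thetas c) (m+3) ≤ RingHom.ker (constantCoeff (R := K) (σ := Fin (m+3))) := by
      rw [qIdeal, Ideal.span_le]
      rintro _ ⟨k, _, rfl⟩
      rw [SetLike.mem_coe, RingHom.mem_ker, constantCoeff_eq]
      exact (thetas_hom c k).coeff_eq_zero (by simp)
    exact this h
  · intro h
    have hk : ∀ k < m+3, thetas c k ∈ qIdeal (thetas c) (m+3) :=
      fun k hk => Ideal.subset_span ⟨k, hk, rfl⟩
    have h2 : ∀ j ≠ 2, X j ∈ qIdeal (thetas c) (m+3) := by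
      intro j hj
      obtain ⟨k, _, hk', h⟩ := X_of_ne_two c j hj
      rw [← h]; exact hk k hk'
    have hf : f ∈ Ideal.span (X '' Set.univ : Set (MvPolynomial (Fin (m+3)) K)) := by
      rw [mem_ideal_span_X_image]
      intro a ha
      by_contra! hcon
      have : a = 0 := by ext i; exact hcon i trivial
      subst this
      exact mem_support_iff.1 ha h
    refine (Ideal.span_le.2 ?_ : Ideal.span _ ≤ _) hf
    rintro _ ⟨j, _, rfl⟩
    by_cases hj : j = 2
    · subst hj
      rw [X_two c hc]
      refine Ideal.mul_mem_left _ _ (Ideal.sub_mem _ (hk 0 (by omega)) ?_)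
      exact Ideal.sum_mem _ fun j hj => Ideal.mul_mem_left _ _ (h2 j (Finset.ne_of_mem_erase hj))
    · exact h2 j hj

end Theta

section Geometry
variable {K : Type} [Field K] {n β : ℕ}

def lv (n : ℕ) (t : K) : Fin (n+1) → K := fun j => if (j : ℕ) = 1 then t else 1

lemma mk_smul_eq {V : Type} [AddCommGroup V] [Module K V] (v : V) (hv : v ≠ 0) (a : K)
    (hav : a • v ≠ 0) :
    Projectivization.mk K (a • v) hav = Projectivization.mk K v hv := by
  rw [Projectivization.mk_eq_mk_iff']; exact ⟨a, rfl⟩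

lemma cons_smul (a : K) (w : Fin n → K) :
    (Fin.cons 0 (a • w) : Fin (n+1) → K) = a • (Fin.cons 0 w : Fin (n+1) → K) := by
  ext i; refine Fin.cases ?_ (fun i => ?_) i <;> simp

lemma mem_I_geom (Γ₀ : Finset (Projectivization K (Fin n → K))) (u : Fin β → K)
    (f : MvPolynomial (Fin (n+1)) K) :
    f ∈ vanishingIdeal (MigGamma Γ₀ u : Set (Projectivization K (Fin (n+1) → K))) ↔
      (∀ (w : Fin n → K) (hw : w ≠ 0), Projectivization.mk K w hw ∈ Γ₀ →
        eval (Fin.cons 0 w : Fin (n+1) → K) f = 0) ∧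
      ∀ i (a : K), a ≠ 0 → eval (a • lv n (u i)) f = 0 := by
  constructor
  · intro hf
    constructor
    · intro w hw hP
      have hw' : (Fin.cons 0 w : Fin (n+1) → K) ≠ 0 := by
        intro h; apply hw; funext i; simpa using congrFun h i.succ
      refine hf (embedPt (Projectivization.mk K w hw)) ?_ _ hw' ?_
      · simp only [MigGamma, Finset.coe_union, Finset.coe_image]
        exact Or.inl ⟨_, hP, rfl⟩
      · obtain ⟨a, ha⟩ := Projectivization.exists_smul_eq_mk_rep K w hw
        rw [embedPt, Projectivization.mk_eq_mk_iff']
        refine ⟨(a⁻¹ : Kˣ), ?_⟩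
        rw [← cons_smul, ← ha]
        congr 1
        exact inv_smul_smul a w
    · intro i a ha
      have h0 : a • lv n (u i) ≠ 0 := by
        intro h
        have := congrFun h 0
        simp [lv, ha] at this
      refine hf (linePt n (u i)) ?_ _ h0 ?_
      · simp only [MigGamma, Finset.coe_union, Finset.coe_image]
        exact Or.inr ⟨i, by simp, rfl⟩
      · rw [linePt, Projectivization.mk_eq_mk_iff']
        exact ⟨a, rfl⟩
  · rintro ⟨h1, h2⟩ P hP v hv rfl
    simp only [MigGamma, Finset.coe_union, Finset.coe_image] at hP
    rcases hP with ⟨P, hP, hv'⟩ | ⟨i, -, hv'⟩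
    · rw [embedPt, eq_comm, Projectivization.mk_eq_mk_iff'] at hv'
      obtain ⟨a, ha⟩ := hv'
      rw [← ha, ← cons_smul]
      have h0 : a • P.rep ≠ 0 := by
        intro h; rw [← cons_smul, h] at ha
        apply hv; rw [← ha]; ext i; refine Fin.cases ?_ (fun i => ?_) i <;> simp
      refine h1 _ h0 ?_
      rw [mk_smul_eq _ P.rep_nonzero, Projectivization.mk_rep]
      exact hP
    · simp only [linePt] at hv'
      rw [eq_comm, Projectivization.mk_eq_mk_iff'] at hv'
      obtain ⟨a, ha⟩ := hv'
      rw [← ha]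
      refine h2 i a ?_
      rintro rfl
      apply hv; rw [← ha, zero_smul]

lemma embedPt_inj : Function.Injective (embedPt (K := K) (m := n)) := by
  intro P Q h
  rw [embedPt, embedPt, Projectivization.mk_eq_mk_iff'] at h
  obtain ⟨a, ha⟩ := h
  rw [← P.mk_rep, ← Q.mk_rep, Projectivization.mk_eq_mk_iff']
  refine ⟨a, ?_⟩
  funext i
  simpa using congrFun ha i.succ

lemma linePt_inj (hn : 1 ≤ n) : Function.Injective (linePt (K := K) n) := by
  intro s t h
  rw [linePt, linePt, Projectivization.mk_eq_mk_iff'] at h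
  obtain ⟨a, ha⟩ := h
  have h0 := congrFun ha 0
  have h1 := congrFun ha ⟨1, by omega⟩
  simp at h0 h1
  rw [← h1, h0, one_mul]

lemma card_Mig (hn : 1 ≤ n) (Γ₀ : Finset (Projectivization K (Fin n → K))) (u : Fin β → K)
    (hu : Function.Injective u) : (MigGamma Γ₀ u).card = Γ₀.card + β := by
  classical
  rw [MigGamma, Finset.card_union_of_disjoint, Finset.card_image_of_injective _ embedPt_inj,
    Finset.card_image_of_injective _ (fun i j h => hu (linePt_inj hn h)), Finset.card_univ, Fintype.card_fin]
  rw [Finset.disjoint_left]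
  intro P hP hP'
  simp only [Finset.mem_image] at hP hP'
  obtain ⟨Q, _, rfl⟩ := hP
  obtain ⟨i, _, h⟩ := hP'
  rw [embedPt, linePt, Projectivization.mk_eq_mk_iff'] at h
  obtain ⟨a, ha⟩ := h
  have := congrFun ha 0
  simp at this

end Geometry
section Restrict
variable {K : Type} [Field K]

lemma eval_smul_hom {N d : ℕ} {f : MvPolynomial (Fin N) K} (hf : f.IsHomogeneous d) (a : K)
    (v : Fin N → K) : eval (a • v) f = a ^ d * eval v f := by
  rw [eval_eq', eval_eq', Finset.mul_sum]
  refine Finset.sum_congr rfl fun x hx => ?_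
  have hx' : ∑ i, x i = d := by
    have := hf (mem_support_iff.1 hx)
    rw [← this, Finsupp.weight_apply, Finsupp.sum_fintype _ _ (by simp)]
    simp
  simp only [Pi.smul_apply, smul_eq_mul, mul_pow]
  rw [Finset.prod_mul_distrib, Finset.prod_pow_eq_pow_sum, hx']
  ring

lemma X_zero_dvd {n d : ℕ} (J : Ideal (MvPolynomial (Fin n) K)) (hJ : hdim J d = 0)
    (f : MvPolynomial (Fin (n+1)) K) (hf : f.IsHomogeneous d)
    (hfJ : aeval (R := K) (Fin.cons 0 X : Fin (n+1) → MvPolynomial (Fin n) K) f ∈ J) :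
    ∃ g, f = X 0 * g := by
  set ψ := aeval (R := K) (Fin.cons 0 X : Fin (n+1) → MvPolynomial (Fin n) K) with hψ
  have hhom : (ψ f).IsHomogeneous d := by
    have := hf.aeval (Fin.cons 0 X : Fin (n+1) → MvPolynomial (Fin n) K) (n := 1) (by
      intro i; refine Fin.cases ?_ (fun i => ?_) i
      · exact isHomogeneous_zero _ _ _
      · simpa using isHomogeneous_X K i)
    rw [one_mul] at this
    exact this
  have hfin : Module.Finite K (homogeneousSubmodule (Fin n) K d) :=
    Module.Finite.iff_fg.2 (homogeneousSubmodule_fg _ _ d)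
  have hfin2 : Module.Finite K (degPart J d) :=
    Submodule.finiteDimensional_of_le (inf_le_right : _ ≤ homogeneousSubmodule (Fin n) K d)
  have hbot : degPart J d = ⊥ := Submodule.finrank_eq_zero.1 hJ
  have h0 : ψ f = 0 := by
    have : ψ f ∈ degPart J d := ⟨hfJ, hhom⟩
    rwa [hbot, Submodule.mem_bot] at this
  have hq : ∀ p, p - rename (Fin.succ : Fin n → Fin (n+1)) (ψ p) ∈
      Ideal.span {(X 0 : MvPolynomial (Fin (n+1)) K)} := by
    intro p
    rw [← Ideal.Quotient.eq]
    have : (Ideal.Quotient.mkₐ K (Ideal.span {(X 0 : MvPolynomial (Fin (n+1)) K)})) =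
      (Ideal.Quotient.mkₐ K (Ideal.span {(X 0 : MvPolynomial (Fin (n+1)) K)})).comp
        ((rename (Fin.succ : Fin n → Fin (n+1))).comp ψ) := by
      ext i
      refine Fin.cases ?_ (fun i => ?_) i
      · simp only [AlgHom.comp_apply, ψ, aeval_X, Fin.cons_zero, map_zero]
        exact Ideal.Quotient.eq_zero_iff_mem.2 (Ideal.mem_span_singleton_self _)
      · simp [ψ]
    exact congrArg (fun F => F p) this
  have := hq f
  rw [h0, map_zero, sub_zero, Ideal.mem_span_singleton] at this
  exact this

lemma hdim_zero {n α d : ℕ} (hn : 1 ≤ n) (J : Ideal (MvPolynomial (Fin n) K))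
    (hJ : HF J d = min ((d + n - 1).choose (n - 1)) α)
    (h : (d + n - 1).choose (n - 1) ≤ α) : hdim J d = 0 := by
  rw [HF, finrank_hom, min_eq_left h] at hJ
  have h1 : (n + d - 1).choose d = (d + n - 1).choose (n - 1) := by
    rw [show n + d - 1 = d + (n-1) by omega, show d + n - 1 = d + (n-1) by omega,
      Nat.choose_symm_add]
  have h2 : 0 < (d + n - 1).choose (n - 1) := Nat.choose_pos (by omega)
  omega

/-- restriction to the line -/
def lineRes (m : ℕ) : MvPolynomial (Fin (m+3)) K →ₐ[K] MvPolynomial (Fin (m+3)) K :=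
  aeval (fun j => if j = 1 then X 1 else X 0)

lemma eval_lineRes {m : ℕ} (w : Fin (m+3) → K) (f) :
    eval w (lineRes m f) = eval (fun j => if j = 1 then w 1 else w 0) f := by
  rw [lineRes, ← coe_aeval_eq_eval, ← coe_aeval_eq_eval]
  change (aeval w) (aeval _ f) = aeval _ f
  rw [← AlgHom.comp_apply, comp_aeval]
  congr 2
  funext j
  split_ifs <;> simp

lemma lv_eq {m : ℕ} (t : K) : lv (m+2) t = fun j => if j = 1 then t else 1 := by
  funext j
  simp only [lv]
  congr 1
  rw [Fin.ext_iff]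
  simp

variable {m β : ℕ} (Γ₀ : Finset (Projectivization K (Fin (m+2) → K))) (u : Fin β → K)

lemma X0_mul_mem (g : MvPolynomial (Fin (m+3)) K) (hg : lineRes m g = 0) :
    X 0 * g ∈ vanishingIdeal (MigGamma Γ₀ u : Set (Projectivization K (Fin (m+2+1) → K))) := by
  rw [mem_I_geom]
  constructor
  · intro w _ _; simp
  · intro i a _
    rw [map_mul]
    have h := eval_lineRes (a • lv (m+2) (u i)) g
    have h2 : (fun j => if j = 1 then (a • lv (m+2) (u i)) 1 else (a • lv (m+2) (u i)) 0) =
        a • lv (m+2) (u i) := by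
      rw [lv_eq]; funext j; by_cases hj : j = 1 <;> simp [hj]
    rw [h2, hg, map_zero] at h
    rw [← h, mul_zero]

lemma X0_prod_mem (u : Fin β → K) : X 0 * prodPoly (m+2) β u ∈
    vanishingIdeal (MigGamma Γ₀ u : Set (Projectivization K (Fin (m+2+1) → K))) := by
  rw [mem_I_geom]
  constructor
  · intro w _ _; simp
  · intro i a _
    rw [map_mul, prodPoly, map_prod, Finset.prod_eq_zero (Finset.mem_univ i), mul_zero]
    rw [lv_eq]
    simp [mul_comm]

variable {Γ₀ u}

lemma low_degree [CharZero K] (hu : Function.Injective u) {d : ℕ}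
    (hJ : hdim (vanishingIdeal (Γ₀ : Set (Projectivization K (Fin (m+2) → K)))) d = 0)
    (hd : d ≤ β) (f : MvPolynomial (Fin (m+3)) K) (hf : f.IsHomogeneous d)
    (hfI : f ∈ vanishingIdeal (MigGamma Γ₀ u : Set (Projectivization K (Fin (m+2+1) → K)))) :
    ∃ g, f = X 0 * g ∧ lineRes m g = 0 := by
  have hfI' := (mem_I_geom _ _ _).1 hfI
  obtain ⟨g, rfl⟩ := X_zero_dvd _ hJ f hf (by
    rintro P hP w hw rfl
    have := hfI'.1 w hw hP
    rw [← coe_aeval_eq_eval] at this ⊢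
    rw [← this]
    change (aeval w) (aeval _ f) = aeval _ f
    rw [← AlgHom.comp_apply, comp_aeval]
    congr 2
    funext j
    refine Fin.cases ?_ (fun i => ?_) j <;> simp)
  refine ⟨g, rfl, ?_⟩
  by_cases hg0 : g = 0
  · rw [hg0, map_zero]
  have hdeg : g.totalDegree + 1 ≤ β := by
    have h1 := hf.totalDegree (mul_ne_zero (X_ne_zero _) hg0)
    rw [totalDegree_mul_of_isDomain (X_ne_zero _) hg0, totalDegree_X] at h1
    omega
  -- vanishing along the whole line
  have hline : ∀ t : K, eval (lv (m+2) t) g = 0 := by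
    let q : Polynomial K := aeval (fun j : Fin (m+3) => if j = 1 then (Polynomial.X : Polynomial K) else 1) g
    have hqe : ∀ t, q.eval t = eval (lv (m+2) t) g := by
      intro t
      rw [← Polynomial.coe_aeval_eq_eval, ← coe_aeval_eq_eval]
      change (Polynomial.aeval t) (aeval _ g) = aeval _ g
      rw [← AlgHom.comp_apply, comp_aeval, lv_eq]
      congr 2
      funext j
      split_ifs <;> simp
    have hqd : q.natDegree ≤ g.totalDegree * 1 := by
      apply aeval_natDegree_le _ le_rfl
      intro i; split_ifs <;> simp
    have hq0 : q = 0 := by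
      apply Polynomial.eq_zero_of_natDegree_lt_card_of_eval_eq_zero q hu
      · intro i
        have := hfI'.2 i 1 one_ne_zero
        rw [one_smul, map_mul, eval_X] at this
        rw [hqe]
        simpa [lv] using this
      · rw [Fintype.card_fin]; omega
    intro t
    rw [← hqe, hq0, Polynomial.eval_zero]
  have hz : lineRes m (X 0 * g) = 0 := by
    apply MvPolynomial.funext
    intro w
    rw [map_zero, eval_lineRes]
    by_cases hw : w 0 = 0
    · rw [map_mul, eval_X]; simp [hw]
    · have : (fun j : Fin (m+3) => if j = 1 then w 1 else w 0) = w 0 • lv (m+2) (w 1 / w 0) := by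
        rw [lv_eq]; funext j; by_cases hj : j = 1
        · simp [hj]; field_simp
        · simp [hj]
      rw [this, eval_smul_hom hf, map_mul, hline, mul_zero, mul_zero]
  rw [map_mul] at hz
  rcases mul_eq_zero.1 hz with h | h
  · simp [lineRes] at h
  · exact h

end Restrict
section Twists
variable {K : Type} [Field K]

lemma hom_deg_pos {N d : ℕ} {f : MvPolynomial (Fin N) K} (hf : f.IsHomogeneous d) (h0 : f ≠ 0)
    (hc : constantCoeff f = 0) : 1 ≤ d := by
  by_contra hd
  have hd0 : d = 0 := by omega
  subst hd0
  have h1 := (totalDegree_eq_zero_iff_eq_C).1 (hf.totalDegree h0)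
  apply h0
  rw [h1, ← constantCoeff_eq, hc, C_0]

lemma twist_ge {N : ℕ} {I : Ideal (MvPolynomial (Fin N) K)} (res : MinFreeRes N K I) (j : ℕ) :
    ∀ i, j + 1 ≤ res.twist (j+1) i := by
  have hmv : ∀ j g k, constantCoeff ((res.mat j).mulVec g k) = 0 := by
    intro j g k
    rw [Matrix.mulVec, dotProduct, map_sum]
    refine Finset.sum_eq_zero fun x _ => ?_
    rw [map_mul, res.mat_min, zero_mul]
  have hno : ∀ j (i : Fin (res.rk (j+1))),
      (Pi.single i 1 : Fin (res.rk (j+1)) → MvPolynomial (Fin N) K) ∉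
        LinearMap.range (res.mat j).mulVecLin := by
    rintro j i ⟨g, hg⟩
    have h1 := hmv j g i
    rw [Matrix.mulVecLin_apply] at hg
    rw [hg] at h1
    simp at h1
  induction j with
  | zero =>
    intro i
    refine hom_deg_pos (res.gen_hom i) ?_ (res.gen_min i)
    intro h
    apply hno 0 i
    rw [← res.exact_one]
    rw [Finset.sum_eq_zero]
    intro k _
    by_cases hk : k = i
    · rw [hk, h, mul_zero]
    · rw [Pi.single_eq_of_ne hk, zero_mul]
  | succ j ih =>
    intro i'
    by_cases hz : ∀ i, res.mat j i i' = 0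
    · exfalso
      apply hno (j+1) i'
      rw [← res.exact_rest, LinearMap.mem_ker, Matrix.mulVecLin_apply]
      funext i
      rw [Matrix.mulVec_single_one]
      exact hz i
    · push Not at hz
      obtain ⟨i, hi⟩ := hz
      rcases res.mat_hom j i i' with h | ⟨d, hd, hd'⟩
      · exact absurd h hi
      · have h1 := hom_deg_pos hd hi (res.mat_min j i i')
        have h2 := ih i
        have : res.twist (j+1+1) i' = d + res.twist (j+1) i := hd'.symm
        omega

end Twists

section Final
variable {K : Type} [Field K] [CharZero K] {m β : ℕ}
  {Γ₀ : Finset (Projectivization K (Fin (m+2) → K))} {u : Fin β → K}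

lemma eval_ell (c v : Fin (m+3) → K) : eval v (ell c) = ∑ j, c j * v j := by
  simp [ell]

lemma exists_c (Γ₀ : Finset (Projectivization K (Fin (m+2) → K))) (u : Fin β → K) :
    ∃ c : Fin (m+3) → K, c 1 ≠ 0 ∧ c 2 ≠ 0 ∧
      (∀ P ∈ Γ₀, eval (Fin.cons 0 P.rep : Fin (m+3) → K) (ell c) ≠ 0) ∧
      ∀ i, eval (lv (m+2) (u i)) (ell c) ≠ 0 := by
  let vec : (Γ₀ ⊕ Fin β) ⊕ Fin 2 → (Fin (m+3) → K) := fun x => match x with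
    | .inl (.inl P) => Fin.cons 0 P.1.rep
    | .inl (.inr i) => lv (m+2) (u i)
    | .inr 0 => Pi.single 1 1
    | .inr 1 => Pi.single 2 1
  have hvec : ∀ x, vec x ≠ 0 := by
    intro x
    match x with
    | .inl (.inl P) =>
      intro h
      apply P.1.rep_nonzero
      funext i
      simpa [vec] using congrFun h i.succ
    | .inl (.inr i) =>
      intro h
      have := congrFun h 0
      simp [vec, lv] at this
    | .inr 0 => simp [vec]
    | .inr 1 => simp [vec]
  obtain ⟨φ, hφ⟩ := Module.exists_dual_forall_apply_ne_zero (K := K) vec hvec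
  have key : ∀ v, eval v (ell fun j => φ (Pi.single j 1)) = φ v := by
    intro v
    rw [eval_ell]
    conv_rhs => rw [pi_eq_sum_univ' v, map_sum]
    refine Finset.sum_congr rfl fun j _ => ?_
    rw [map_smul, smul_eq_mul, mul_comm]
  refine ⟨fun j => φ (Pi.single j 1), hφ (.inr 0), hφ (.inr 1), ?_, ?_⟩
  · intro P hP
    rw [key]; exact hφ (.inl (.inl ⟨P, hP⟩))
  · intro i
    rw [key]; exact hφ (.inl (.inr i))

lemma ell_nzd (c : Fin (m+3) → K)
    (h1 : ∀ P ∈ Γ₀, eval (Fin.cons 0 P.rep : Fin (m+3) → K) (ell c) ≠ 0)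
    (h2 : ∀ i, eval (lv (m+2) (u i)) (ell c) ≠ 0) (f)
    (hf : ell c * f ∈ vanishingIdeal (MigGamma Γ₀ u : Set (Projectivization K (Fin (m+2+1) → K)))) :
    f ∈ vanishingIdeal (MigGamma Γ₀ u : Set (Projectivization K (Fin (m+2+1) → K))) := by
  rw [mem_I_geom] at hf ⊢
  constructor
  · intro w hw hP
    have h := hf.1 w hw hP
    rw [map_mul] at h
    refine (mul_eq_zero.1 h).resolve_left ?_
    intro h0
    apply h1 _ hP
    obtain ⟨a, ha⟩ := Projectivization.exists_smul_eq_mk_rep K w hw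
    have : (Fin.cons 0 (Projectivization.mk K w hw).rep : Fin (m+3) → K) =
        (a : K) • (Fin.cons 0 w : Fin (m+3) → K) := by
      rw [← cons_smul, ← ha]; rfl
    rw [this, eval_smul_hom (ell_hom c), h0, mul_zero]
  · intro i a ha
    have h := hf.2 i a ha
    rw [map_mul] at h
    refine (mul_eq_zero.1 h).resolve_left ?_
    rw [eval_smul_hom (ell_hom c)]
    exact mul_ne_zero (pow_ne_zero _ ha) (h2 i)

lemma low_decomp (hu : Function.Injective u)
    (hJ : ∀ d ≤ β, hdim (vanishingIdeal (Γ₀ : Set (Projectivization K (Fin (m+2) → K)))) d = 0)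
    (hIhom : ∀ f ∈ vanishingIdeal (MigGamma Γ₀ u : Set (Projectivization K (Fin (m+2+1) → K))),
      ∀ e, homogeneousComponent e f ∈
        vanishingIdeal (MigGamma Γ₀ u : Set (Projectivization K (Fin (m+2+1) → K))))
    (c : Fin (m+3) → K) {d : ℕ} (hd1 : 1 ≤ d) (hd : d ≤ β)
    (h : MvPolynomial (Fin (m+3)) K) (hh : h.IsHomogeneous d)
    (hmem : h ∈ vanishingIdeal (MigGamma Γ₀ u : Set (Projectivization K (Fin (m+2+1) → K))) ⊔
      Ideal.span {ell c}) :
    ∃ g r, h = X 0 * g + ell c * r ∧ lineRes m g = 0 := by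
  obtain ⟨i, hi, y, hy, hiy⟩ := Submodule.mem_sup.1 hmem
  obtain ⟨r, rfl⟩ := Ideal.mem_span_singleton.1 hy
  have h1 : h = homogeneousComponent d i + ell c * homogeneousComponent (d-1) r := by
    rw [← hc_mul_of_le (ell_hom c) hd1, ← map_add, hiy]
    exact (homogeneousComponent_eq_self hh).symm
  obtain ⟨g, hg, hg'⟩ := low_degree hu (hJ d hd) hd _ (homogeneousComponent_isHomogeneous d i)
    (hIhom i hi d)
  exact ⟨g, _, by rw [h1, hg], hg'⟩

end Final
section Final2
variable {K : Type} [Field K] [CharZero K] {m β : ℕ}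
  {Γ₀ : Finset (Projectivization K (Fin (m+2) → K))} {u : Fin β → K}

/-- sum of the coefficients other than the one of `x_1` -/
def cS (c : Fin (m+3) → K) : K := ∑ j ∈ Finset.univ.erase 1, c j

lemma eval_lv_ell (c : Fin (m+3) → K) (t : K) :
    eval (lv (m+2) t) (ell c) = c 1 * t + cS c := by
  rw [eval_ell, ← Finset.add_sum_erase _ _ (Finset.mem_univ 1), lv_eq, cS]
  congr 1
  · refine Finset.sum_congr rfl fun j hj => ?_
    simp only [if_neg (Finset.ne_of_mem_erase hj), mul_one]

lemma lineRes_ell (c : Fin (m+3) → K) :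
    lineRes m (ell c) = C (cS c) * X 0 + C (c 1) * X 1 := by
  rw [ell, map_sum, ← Finset.add_sum_erase _ _ (Finset.mem_univ 1), cS]
  refine (add_comm _ _).trans ?_
  congr 1
  · rw [map_sum C, Finset.sum_mul]
    refine Finset.sum_congr rfl fun j hj => ?_
    simp [lineRes, Finset.ne_of_mem_erase hj, algHom_C]
  · simp [lineRes, algHom_C]

lemma lineRes_idem (f : MvPolynomial (Fin (m+3)) K) :
    lineRes m (lineRes m f) = lineRes m f := by
  have : (lineRes (K := K) m).comp (lineRes m) = lineRes m := by
    ext1 j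
    by_cases hj : j = 1 <;> simp [lineRes, hj]
  exact congrArg (fun F => F f) this

lemma eval_lv_of_lineRes (t : K) (g : MvPolynomial (Fin (m+3)) K) (hg : lineRes m g = 0) :
    eval (lv (m+2) t) g = 0 := by
  have h := eval_lineRes (lv (m+2) t) g
  rw [hg, map_zero] at h
  rw [h]
  congr 2
  rw [lv_eq]
  funext j
  by_cases hj : j = 1 <;> simp [hj]

lemma socle_not_mem (hβ : 0 < β) (hu : Function.Injective u)
    (hJ : ∀ d ≤ β, hdim (vanishingIdeal (Γ₀ : Set (Projectivization K (Fin (m+2) → K)))) d = 0)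
    (hIhom : ∀ f ∈ vanishingIdeal (MigGamma Γ₀ u : Set (Projectivization K (Fin (m+2+1) → K))),
      ∀ e, homogeneousComponent e f ∈
        vanishingIdeal (MigGamma Γ₀ u : Set (Projectivization K (Fin (m+2+1) → K))))
    (c : Fin (m+3) → K) (hc1 : c 1 ≠ 0) :
    X 0 ^ β ∉ vanishingIdeal (MigGamma Γ₀ u : Set (Projectivization K (Fin (m+2+1) → K))) ⊔
      Ideal.span {ell c} := by
  intro hmem
  obtain ⟨g, r, h, hg⟩ := low_decomp hu hJ hIhom c hβ le_rfl _ (isHomogeneous_X_pow 0 β) hmem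
  have h1 := congrArg (eval (lv (m+2) (-(cS c) / c 1))) h
  rw [map_add, map_mul, map_mul, eval_lv_of_lineRes _ g hg, eval_lv_ell, map_pow, eval_X,
    mul_div_cancel₀ _ hc1] at h1
  simp [lv] at h1

lemma socle_mem (hβ : 0 < β) (c : Fin (m+3) → K) (hc1 : c 1 ≠ 0)
    (h2 : ∀ i, eval (lv (m+2) (u i)) (ell c) ≠ 0) (j : Fin (m+3)) :
    X j * X 0 ^ β ∈
      vanishingIdeal (MigGamma Γ₀ u : Set (Projectivization K (Fin (m+2+1) → K))) ⊔
      Ideal.span {ell c} := by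
  set Λ := vanishingIdeal (MigGamma Γ₀ u : Set (Projectivization K (Fin (m+2+1) → K))) ⊔
      Ideal.span {ell c} with hΛ
  let π := Ideal.Quotient.mk Λ
  have hI : ∀ f ∈ vanishingIdeal (MigGamma Γ₀ u : Set (Projectivization K (Fin (m+2+1) → K))),
      π f = 0 := fun f hf => Ideal.Quotient.eq_zero_iff_mem.2 (Ideal.mem_sup_left hf)
  have hl : π (ell c) = 0 :=
    Ideal.Quotient.eq_zero_iff_mem.2 (Ideal.mem_sup_right (Ideal.mem_span_singleton_self _))
  have hj : ∀ j, j ≠ 1 → π (X 0) * π (X j) = π (X 0) * π (X 0) := by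
    intro j hj
    have := hI _ (X0_mul_mem Γ₀ u (X j - X 0) (by simp [lineRes, hj]))
    rw [map_mul, map_sub, mul_sub, sub_eq_zero] at this
    exact this
  let t : K := -(cS c) / c 1
  have ht : c 1 * t = - cS c := mul_div_cancel₀ _ hc1
  have hinv : π (C (c 1)⁻¹) * π (C (c 1)) = 1 := by
    rw [← map_mul, ← C_mul, inv_mul_cancel₀ hc1, C_1, map_one]
  have h1 : π (X 0) * π (X 1) = π (C t) * (π (X 0) * π (X 0)) := by
    have h3 : π (X 0) * π (ell c) = π (C (c 1)) * (π (X 0) * π (X 1)) +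
        π (C (cS c)) * (π (X 0) * π (X 0)) := by
      rw [ell, map_sum, Finset.mul_sum, ← Finset.add_sum_erase _ _ (Finset.mem_univ 1), cS]
      congr 1
      · rw [map_mul]; ring
      · rw [map_sum C, map_sum π, Finset.sum_mul]
        refine Finset.sum_congr rfl fun j hj' => ?_
        rw [← hj j (Finset.ne_of_mem_erase hj'), map_mul]; ring
    rw [hl, mul_zero] at h3
    have h4 : π (C (c 1)) * π (C t) = - π (C (cS c)) := by
      rw [← map_mul, ← C_mul, ht, map_neg, map_neg]
    linear_combination (-π (C (c 1)⁻¹)) * h3 + (π (C t) * (π (X 0) * π (X 0)) - π (X 0) * π (X 1)) * hinv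
      - π (C (c 1)⁻¹) * π (X 0) * π (X 0) * h4
  have hprod : ∀ s : Finset (Fin β), π (X 0) * ∏ i ∈ s, (π (C (u i)) * π (X 0) - π (X 1)) =
      π (C (∏ i ∈ s, (u i - t))) * π (X 0) ^ (s.card + 1) := by
    classical
    intro s
    induction s using Finset.induction_on with
    | empty => simp
    | insert a s ha ih =>
      rw [Finset.prod_insert ha, Finset.prod_insert ha, Finset.card_insert_of_notMem ha, C_mul,
        map_mul, C_sub, map_sub]
      linear_combination (π (C (u a)) * π (X 0) - π (X 1)) * ih -
        π (C (∏ i ∈ s, (u i - t))) * π (X 0) ^ s.card * h1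
  have hpow : π (X 0) ^ (β + 1) = 0 := by
    have h3 := hI _ (X0_prod_mem Γ₀ u)
    have h4 := hprod Finset.univ
    rw [prodPoly, map_mul, map_prod] at h3
    simp only [map_sub, map_mul] at h3
    simp only [Finset.card_univ, Fintype.card_fin] at h4
    rw [h3] at h4
    have hne : ∏ i, (u i - t) ≠ 0 := by
      rw [Finset.prod_ne_zero_iff]
      intro i _ h0
      apply h2 i
      rw [eval_lv_ell, sub_eq_zero.1 h0, ht, neg_add_cancel]
    calc π (X 0) ^ (β + 1) = π (C (∏ i, (u i - t))⁻¹ * C (∏ i, (u i - t))) * π (X 0) ^ (β + 1) := by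
          rw [← C_mul, inv_mul_cancel₀ hne, C_1, map_one, one_mul]
      _ = 0 := by rw [map_mul, mul_assoc, ← h4, mul_zero]
  rw [← Ideal.Quotient.eq_zero_iff_mem]
  change π _ = 0
  obtain ⟨b, rfl⟩ : ∃ b, β = b + 1 := ⟨β - 1, by omega⟩
  rw [map_mul, map_pow]
  by_cases hj1 : j = 1
  · subst hj1
    linear_combination π (X 0) ^ b * h1 + π (C t) * hpow
  · linear_combination π (X 0) ^ b * hj j hj1 + hpow

lemma no_low_socle (hu : Function.Injective u)
    (hJ : ∀ d ≤ β, hdim (vanishingIdeal (Γ₀ : Set (Projectivization K (Fin (m+2) → K)))) d = 0)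
    (hIhom : ∀ f ∈ vanishingIdeal (MigGamma Γ₀ u : Set (Projectivization K (Fin (m+2+1) → K))),
      ∀ e, homogeneousComponent e f ∈
        vanishingIdeal (MigGamma Γ₀ u : Set (Projectivization K (Fin (m+2+1) → K))))
    (c : Fin (m+3) → K) (hc1 : c 1 ≠ 0) (hc2 : c 2 ≠ 0) {e : ℕ} (he : e < β)
    (b : MvPolynomial (Fin (m+3)) K) (hb : b.IsHomogeneous e)
    (hb0 : X 0 * b ∈ vanishingIdeal (MigGamma Γ₀ u : Set (Projectivization K (Fin (m+2+1) → K))) ⊔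
      Ideal.span {ell c})
    (hb1 : X 1 * b ∈ vanishingIdeal (MigGamma Γ₀ u : Set (Projectivization K (Fin (m+2+1) → K))) ⊔
      Ideal.span {ell c}) :
    b ∈ vanishingIdeal (MigGamma Γ₀ u : Set (Projectivization K (Fin (m+2+1) → K))) ⊔
      Ideal.span {ell c} := by
  have hq1 : ∀ f, f ∈ qIdeal (thetas c) 1 ↔ ∃ y, f = ell c * y := by
    intro f
    rw [mem_qIdeal_succ, qIdeal_zero]
    simp only [Ideal.mem_bot, sub_eq_zero]
    rfl
  have hq2 : ∀ f, f ∈ qIdeal (thetas c) 2 ↔ ∃ x y, f = X 0 * x + ell c * y := by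
    intro f
    rw [mem_qIdeal_succ]
    simp only [hq1, sub_eq_iff_eq_add']
    rfl
  obtain ⟨g0, r0, h0, hg0⟩ := low_decomp hu hJ hIhom c (d := e+1) (by omega) (by omega) (X 0 * b)
    (by have h := (isHomogeneous_X K 0).mul hb; rwa [add_comm 1 e] at h) hb0
  obtain ⟨g1, r1, h1, hg1⟩ := low_decomp hu hJ hIhom c (d := e+1) (by omega) (by omega) (X 1 * b)
    (by have h := (isHomogeneous_X K 1).mul hb; rwa [add_comm 1 e] at h) hb1
  obtain ⟨r, hr⟩ := (hq1 _).1 (q_cancel (thetas c) (thetas_surj c hc2) 1 (by omega) (b - g0)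
    ((hq1 _).2 ⟨r0, by
      change X 0 * (b - g0) = _
      rw [mul_sub, h0]; ring⟩))
  obtain ⟨h, r', hr'⟩ := (hq2 _).1 (q_cancel (thetas c) (thetas_surj c hc2) 2 (by omega) g0
    ((hq2 _).2 ⟨g1, r1 - X 1 * r, by
      change X 1 * g0 = _
      linear_combination h1 - X 1 * hr⟩))
  -- restrict to the line
  have hφ : X 0 * lineRes m h + (C (cS c) * X 0 + C (c 1) * X 1) * lineRes m r' = 0 := by
    rw [← lineRes_ell, ← hg0, hr', map_add, map_mul, map_mul]
    simp [lineRes]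
  have hdvd : (X 0 : MvPolynomial (Fin (m+3)) K) ∣ X 1 * lineRes m r' := by
    refine ⟨- C (c 1)⁻¹ * (lineRes m h + C (cS c) * lineRes m r'), ?_⟩
    have hinv : (C (c 1)⁻¹ : MvPolynomial (Fin (m+3)) K) * C (c 1) = 1 := by
      rw [← C_mul, inv_mul_cancel₀ hc1, C_1]
    linear_combination C (c 1)⁻¹ * hφ - X 1 * lineRes m r' * hinv
  obtain ⟨q, hq⟩ : (X 0 : MvPolynomial (Fin (m+3)) K) ∣ lineRes m r' := by
    refine (X_prime.dvd_or_dvd hdvd).resolve_left ?_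
    rw [X_dvd_X]
    simp
  have hX0 : lineRes m (X 0 : MvPolynomial (Fin (m+3)) K) = X 0 := by simp [lineRes]
  have hqq : lineRes m q = q := by
    have := congrArg (lineRes m) hq
    rw [lineRes_idem, hq, map_mul, hX0] at this
    exact (mul_left_cancel₀ (X_ne_zero _) this).symm
  have hz : lineRes m (h + ell c * q) = 0 := by
    rw [map_add, map_mul, hqq, lineRes_ell]
    apply mul_left_cancel₀ (X_ne_zero (R := K) (0 : Fin (m+3)))
    linear_combination hφ - (C (cS c) * X 0 + C (c 1) * X 1) * hq
  have hmem := X0_mul_mem Γ₀ u _ hz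
  have hb' : b = X 0 * (h + ell c * q) + ell c * (r + r' - X 0 * q) := by
    linear_combination hr + hr'
  rw [hb']
  exact add_mem (Ideal.mem_sup_left hmem) (Ideal.mem_sup_right
    (Ideal.mul_mem_right _ _ (Ideal.mem_span_singleton_self _)))

end Final2
lemma aMin_eq {K : Type} [Field K] {N : ℕ} {I : Ideal (MvPolynomial (Fin N) K)}
    (res : MinFreeRes N K I) (n a : ℕ) (hlen : res.len = n)
    (h1 : ∃ i, res.twist n i = a) (h2 : ∀ i, a ≤ res.twist n i) : res.aMin = a := by
  subst hlen
  obtain ⟨i, hi⟩ := h1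
  apply le_antisymm
  · rw [← hi]
    exact Finset.inf'_le _ (Finset.mem_univ i)
  · exact Finset.le_inf' _ _ fun i _ => h2 i

/-- In the Migliore construction with `α ≥ β + n - 2`, if
`s ≥ β + 2` then the minimum socle degree satisfies `A_n = β`, and hence
`d(Γ) = β = A_n`. -/
theorem migliore_s_ge_beta_add_two
    {K : Type} [Field K] [CharZero K] {n α β : ℕ} (hn : 2 ≤ n)
    (hα : 0 < α) (hβ : 0 < β)
    (Γ₀ : Finset (Projectivization K (Fin n → K)))
    (hcard : Γ₀.card = α)
    (hgen : ∀ i, HF (vanishingIdeal (Γ₀ : Set (Projectivization K (Fin n → K)))) i =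
      min ((i + n - 1).choose (n - 1)) α)
    (u : Fin β → K) (hu : Function.Injective u)
    (s : ℕ) (hs : α < (s + n - 1).choose (n - 1))
    (hsmin : ∀ j, α < (j + n - 1).choose (n - 1) → s ≤ j)
    (v : ℕ) (hvs : v = s ∨ v = s + 1)
    (hv : vanishingIdeal (Γ₀ : Set (Projectivization K (Fin n → K))) ⊔
        Ideal.span {f | ∃ i : Fin n, 1 ≤ (i : ℕ) ∧ f = X i} =
      Ideal.span ({X (⟨0, by omega⟩ : Fin n) ^ v} ∪ {f | ∃ i : Fin n, 1 ≤ (i : ℕ) ∧ f = X i}))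
    (hαβ : β + n - 2 ≤ α)
    (hhyp : hyp (MigGamma Γ₀ u) = α)
    (res : MinFreeRes (n + 1) K
      (vanishingIdeal ((MigGamma Γ₀ u) : Set (Projectivization K (Fin (n + 1) → K)))))
    (hlen : res.len = n)
    (hsβ : β + 2 ≤ s) :
    res.A = (β : ℤ) ∧ minDist (MigGamma Γ₀ u) = β ∧
      (minDist (MigGamma Γ₀ u) : ℤ) = res.A := by
  clear hv
  obtain ⟨m, rfl⟩ : ∃ m, n = m + 2 := ⟨n - 2, by omega⟩
  have hdist : minDist (MigGamma Γ₀ u) = β := by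
    rw [minDist, hhyp, card_Mig (by omega) Γ₀ u hu, hcard]
    omega
  have hJ : ∀ d ≤ β,
      hdim (vanishingIdeal (Γ₀ : Set (Projectivization K (Fin (m+2) → K)))) d = 0 := by
    intro d hd
    refine hdim_zero (by omega) _ (hgen d) ?_
    by_contra hcon
    have := hsmin d (by omega)
    omega
  have hIhom : ∀ f ∈ vanishingIdeal
      (MigGamma Γ₀ u : Set (Projectivization K (Fin (m+2+1) → K))),
      ∀ e, homogeneousComponent e f ∈
        vanishingIdeal (MigGamma Γ₀ u : Set (Projectivization K (Fin (m+2+1) → K))) := by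
    intro f hf e
    rw [← res.gen_span] at hf ⊢
    refine hc_mem_span _ ?_ hf e
    rintro _ ⟨i, rfl⟩
    exact ⟨_, res.gen_hom i⟩
  obtain ⟨c, hc1, hc2, hP, hL⟩ := exists_c Γ₀ u
  have htw : ∀ e, (∃ i, res.twist (m+2) i = e + (m+2)) ↔ ∃ b : MvPolynomial (Fin (m+2+1)) K,
      b.IsHomogeneous e ∧
      b ∉ vanishingIdeal (MigGamma Γ₀ u : Set (Projectivization K (Fin (m+2+1) → K))) ⊔
        Ideal.span {ell c} ∧
      ∀ i, 1 ≤ i → i ≤ m+2 → thetas c i * b ∈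
        vanishingIdeal (MigGamma Γ₀ u : Set (Projectivization K (Fin (m+2+1) → K))) ⊔
        Ideal.span {ell c} := by
    intro e
    exact twist_iff res (m+2) (thetas c) (m+1) e rfl hlen (thetas_max c hc2) (thetas_hom c)
      (fun k hk f => q_cancel (thetas c) (thetas_surj c hc2) k (by omega) f)
      (ell_nzd c hP hL)
  have hamin : res.aMin = β + (m+2) := by
    refine aMin_eq res (m+2) _ hlen ?_ ?_
    · rw [htw]
      refine ⟨X 0 ^ β, isHomogeneous_X_pow 0 β, socle_not_mem hβ hu hJ hIhom c hc1, ?_⟩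
      intro i hi hi'
      obtain ⟨j, hj⟩ := thetas_X c i hi (by omega)
      rw [hj]
      exact socle_mem hβ c hc1 hL j
    · intro i
      by_contra hcon
      have hge : m + 2 ≤ res.twist (m+2) i := twist_ge res (m+1) i
      obtain ⟨b, hb, hbn, hbs⟩ := (htw (res.twist (m+2) i - (m+2))).1 ⟨i, by omega⟩
      exact hbn (no_low_socle hu hJ hIhom c hc1 hc2 (by omega) b hb
        (hbs 1 le_rfl (by omega)) (hbs 2 (by omega) (by omega)))
  have hA : res.A = (β : ℤ) := by
    rw [MinFreeRes.A, hamin, hlen]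
    push_cast
    ring
  exact ⟨hA, hdist, by rw [hdist, hA]⟩

end PointsMinDist
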